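/- arXiv:1601.05629 — 9 statements merged into one kernel-verified Lean document; each statement's English description precedes it below -/
import Mathlib

section
/- Let f be a nonzero real polynomial palindromic of darga n and g a nonzero real polynomial palindromic of darga m, with m ≤ n. If g divides f and f = g·h, then the quotient h is palindromic of darga n − m. -/
open Polynomial

/-- A real polynomial is palindromic of darga `n` (the zero polynomial counts
as palindromic of every darga). -/
def PalinDarga (f : Polynomial ℝ) (n : ℕ) : Prop :=
  f.natDegree ≤ n ∧ ∀ i ≤ n, f.coeff i = f.coeff (n - i)

/-- if `f` is a nonzero palindromic polynomial of darga `n`, `g` a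
nonzero palindromic polynomial of darga `m` with `m ≤ n`, and `g` divides `f`
with quotient `h` (i.e. `f = g * h`), then `h` is palindromic of darga `n - m`. -/
theorem palindromic_of_div (f g h : Polynomial ℝ) (n m : ℕ)
    (hf0 : f ≠ 0) (hg0 : g ≠ 0)
    (hf : PalinDarga f n) (hg : PalinDarga g m) (hmn : m ≤ n)
    (hfgh : f = g * h) :
    PalinDarga h (n - m) := by
  obtain ⟨hfd, hfc⟩ := hf
  obtain ⟨hgd, hgc⟩ := hg
  have refl : ∀ (p : Polynomial ℝ) (k : ℕ), (∀ i ≤ k, p.coeff i = p.coeff (k - i)) →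
      reflect k p = p := by
    intro p k hp
    ext i
    rw [coeff_reflect]
    by_cases hi : i ≤ k
    · rw [revAt_le hi, ← hp i hi]
    · rw [revAt_eq_self_of_lt (by omega)]
  have hF := refl f n hfc
  have hG := refl g m hgc
  -- reflect at a darga large enough for `h`
  set d := h.natDegree with hd
  have h1 : reflect (n + d) (f * 1) = f * X ^ d := by
    rw [reflect_mul f 1 hfd (by simp), hF, reflect_one]
  have h2 : reflect (m + (n - m + d)) (g * h) = g * reflect (n - m + d) h := by
    rw [reflect_mul g h hgd (by omega), hG]
  have e : m + (n - m + d) = n + d := by omega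
  rw [e, ← hfgh] at h2
  rw [mul_one, h2, hfgh, mul_assoc] at h1
  have h3 : reflect (n - m + d) h = h * X ^ d := mul_left_cancel₀ hg0 h1
  have h4 : ∀ i, h.coeff i = h.coeff (revAt (n - m + d) (i + d)) := by
    intro i
    rw [← coeff_reflect, h3, coeff_mul_X_pow]
  refine ⟨natDegree_le_iff_coeff_eq_zero.2 fun i hi => ?_, fun i hi => ?_⟩
  · rw [h4, revAt_eq_self_of_lt (by omega)]
    exact coeff_eq_zero_of_natDegree_lt (by omega)
  · rw [h4, revAt_le (by omega)]
    congr 1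
    omega
end

section
/- Let (f_j)_{j≥0} be a sequence of real polynomials such that each f_j is palindromic of darga j and has nonzero constant term. Let p be a real polynomial with deg p ≤ n. Then p is palindromic of darga n (or zero) if and only if there exist real numbers c_0, c_1, …, c_{⌊n/2⌋} such that p(q) = Σ_{j=0}^{⌊n/2⌋} c_j q^j f_{n−2j}(q). Consequently, the space P_n of polynomials palindromic of darga n (together with 0) is a real vector space of dimension ⌊n/2⌋ + 1, with basis { q^j f_{n−2j}(q) : j = 0, 1, …, ⌊n/2⌋ }. -/
open Polynomial

theorem palin_sub {p q : Polynomial ℝ} {n : ℕ} (hp : PalinDarga p n) (hq : PalinDarga q n) :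
    PalinDarga (p - q) n := by
  refine ⟨(natDegree_sub_le p q).trans (max_le hp.1 hq.1), fun i hi => ?_⟩
  rw [coeff_sub, coeff_sub, hp.2 i hi, hq.2 i hi]

theorem palin_sum {n : ℕ} (s : Finset ℕ) (g : ℕ → Polynomial ℝ)
    (h : ∀ j ∈ s, PalinDarga (g j) n) : PalinDarga (∑ j ∈ s, g j) n := by
  refine ⟨natDegree_sum_le_of_forall_le s g fun j hj => (h j hj).1, fun i hi => ?_⟩
  rw [finset_sum_coeff, finset_sum_coeff]
  exact Finset.sum_congr rfl fun j hj => (h j hj).2 i hi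

theorem coeff_term (a : ℝ) (j i : ℕ) (g : Polynomial ℝ) :
    (C a * X ^ j * g).coeff i = if j ≤ i then a * g.coeff (i - j) else 0 := by
  rw [mul_assoc, coeff_C_mul, coeff_X_pow_mul']
  split_ifs <;> simp

theorem palin_term {n j : ℕ} (hj : 2 * j ≤ n) (a : ℝ) {g : Polynomial ℝ}
    (hg : PalinDarga g (n - 2 * j)) : PalinDarga (C a * X ^ j * g) n := by
  have hz : ∀ i, n - 2 * j < i → g.coeff i = 0 := fun i hi =>
    coeff_eq_zero_of_natDegree_lt (lt_of_le_of_lt hg.1 hi)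
  refine ⟨natDegree_le_iff_coeff_eq_zero.2 fun i hi => ?_, fun i hi => ?_⟩
  · rw [coeff_term, hz _ (by omega)]; simp
  · rw [coeff_term, coeff_term]
    by_cases h1 : j ≤ i <;> by_cases h2 : j ≤ n - i
    · rw [if_pos h1, if_pos h2, hg.2 (i - j) (by omega)]
      congr 2; omega
    · rw [if_pos h1, if_neg h2, hz _ (by omega), mul_zero]
    · rw [if_neg h1, if_pos h2, hz _ (by omega), mul_zero]
    · rw [if_neg h1, if_neg h2]

theorem approx_comb (f : ℕ → Polynomial ℝ) (hf : ∀ j, (f j).coeff 0 ≠ 0)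
    (n : ℕ) (p : Polynomial ℝ) (k : ℕ) :
    ∃ c : ℕ → ℝ, ∀ i < k,
      (p - ∑ j ∈ Finset.range k, C (c j) * X ^ j * f (n - 2 * j)).coeff i = 0 := by
  induction k with
  | zero => exact ⟨0, fun i hi => by omega⟩
  | succ k ih =>
    obtain ⟨c, hc⟩ := ih
    set r := p - ∑ j ∈ Finset.range k, C (c j) * X ^ j * f (n - 2 * j) with hr
    refine ⟨Function.update c k (r.coeff k / (f (n - 2 * k)).coeff 0), fun i hi => ?_⟩
    have hs : ∑ j ∈ Finset.range k,
        C (Function.update c k (r.coeff k / (f (n - 2 * k)).coeff 0) j) * X ^ j * f (n - 2 * j)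
        = ∑ j ∈ Finset.range k, C (c j) * X ^ j * f (n - 2 * j) := by
      refine Finset.sum_congr rfl fun j hj => ?_
      rw [Function.update_of_ne (Finset.mem_range.1 hj).ne]
    rw [Finset.sum_range_succ, hs, ← sub_sub, ← hr, Function.update_self, coeff_sub, coeff_term]
    rcases Nat.lt_succ_iff_lt_or_eq.1 hi with h | rfl
    · rw [hc i h, if_neg (by omega), sub_zero]
    · have := hf (n - 2 * i)
      rw [if_pos le_rfl, Nat.sub_self, div_mul_cancel₀ _ this, sub_self]

/-- given a sequence of basic palindromic polynomials `f_j`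
(`f_j` palindromic of darga `j` with nonzero constant term), a polynomial `p` of
degree at most `n` is palindromic of darga `n` (or zero) iff it is a linear
combination `Σ_{j=0}^{⌊n/2⌋} c_j q^j f_{n-2j}`; moreover the family
`{q^j f_{n-2j} : 0 ≤ j ≤ ⌊n/2⌋}` is linearly independent, so the space of
palindromic polynomials of darga `n` has dimension `⌊n/2⌋ + 1` with this basis. -/
theorem palindromic_iff_comb_basic (f : ℕ → Polynomial ℝ)
    (hf : ∀ j, PalinDarga (f j) j ∧ (f j).coeff 0 ≠ 0)
    (n : ℕ) (p : Polynomial ℝ) (hp : p.natDegree ≤ n) :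
    (PalinDarga p n ↔ ∃ c : ℕ → ℝ,
        p = ∑ j ∈ Finset.range (n / 2 + 1), C (c j) * X ^ j * f (n - 2 * j)) ∧
    LinearIndependent ℝ (fun j : Fin (n / 2 + 1) => X ^ (j : ℕ) * f (n - 2 * (j : ℕ))) := by
  have hsum : ∀ c : ℕ → ℝ,
      PalinDarga (∑ j ∈ Finset.range (n / 2 + 1), C (c j) * X ^ j * f (n - 2 * j)) n :=
    fun c => palin_sum _ _ fun j hj =>
      palin_term (by have := Finset.mem_range.1 hj; omega) _ (hf _).1
  refine ⟨⟨fun h => ?_, ?_⟩, ?_⟩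
  · obtain ⟨c, hc⟩ := approx_comb f (fun j => (hf j).2) n p (n / 2 + 1)
    refine ⟨c, sub_eq_zero.1 ?_⟩
    have hpal := palin_sub h (hsum c)
    ext i
    rw [coeff_zero]
    by_cases h1 : i < n / 2 + 1
    · exact hc i h1
    · by_cases h2 : i ≤ n
      · rw [hpal.2 i h2]
        exact hc _ (by omega)
      · exact coeff_eq_zero_of_natDegree_lt (lt_of_le_of_lt hpal.1 (by omega))
  · rintro ⟨c, rfl⟩
    exact hsum c
  · rw [Fintype.linearIndependent_iff]
    intro g hg
    have key : ∀ m : ℕ, ∀ hm : m < n / 2 + 1, g ⟨m, hm⟩ = 0 := by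
      intro m
      induction m using Nat.strong_induction_on with
      | _ m ih =>
        intro hm
        have h := congrArg (fun q => coeff q m) hg
        simp only [finset_sum_coeff, coeff_zero, smul_eq_C_mul, ← mul_assoc, coeff_term] at h
        rw [Finset.sum_eq_single (⟨m, hm⟩ : Fin (n / 2 + 1))] at h
        · simpa [(hf (n - 2 * m)).2] using h
        · rintro ⟨b, hb⟩ - hne
          have hne' : b ≠ m := fun e => hne (Fin.ext e)
          by_cases hbm : b ≤ m
          · rw [if_pos hbm, ih b (by omega) hb, zero_mul]
          · exact if_neg hbm
        · intro h; exact absurd (Finset.mem_univ _) h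
    exact fun i => key i i.2
end

section
/- For every natural number n ≥ 1, the polynomial identity 1 + q^n = Σ_{i=0}^{⌊n/2⌋} (−1)^i [ binomial(n−i, i) + binomial(n−i−1, i−1) ] q^i (1+q)^{n−2i} holds, where binomial(m, k) = 0 when k < 0 or k > m; the coefficient (−1)^i [binomial(n−i,i) + binomial(n−i−1,i−1)] equals (−1)^i (n/(n−i)) binomial(n−i, i) when i < n. Consequently, the transition matrix M(B,S) from the basis {q^j (1+q)^{n−2j}} to the basis {q^j S_{n−2j}} of P_n has (i,j) entry (−1)^{i−j} ((n−2j)/(n−i−j)) binomial(n−i−j, i−j) for 0 ≤ j ≤ i ≤ ⌊n/2⌋. -/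
open Polynomial

/-- The basic palindromic polynomials `S_0 = 1`, `S_k = 1 + q^k` for `k ≥ 1`. -/
noncomputable def Spoly : ℕ → Polynomial ℝ := fun k => if k = 0 then 1 else 1 + X ^ k

/-- The (integer) Chebyshev inversion coefficient
`C(n,i) = (-1)^i [binom(n-i, i) + binom(n-i-1, i-1)]`, where `binom(n-i-1, i-1)`
is taken to be `0` when `i = 0`. -/
def cheb (n i : ℕ) : ℤ :=
  (-1) ^ i * ((n - i).choose i + if 0 < i then (n - i - 1).choose (i - 1) else 0)

lemma cheb_rec (k i : ℕ) :
    cheb (i + (k + 1) + 2) (i + 1) = cheb (i + (k + 1) + 1) (i + 1) - cheb (i + (k + 1)) i := by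
  unfold cheb
  have h1 : i + (k + 1) + 2 - (i + 1) = k + 2 := by omega
  have h2 : i + (k + 1) + 1 - (i + 1) = k + 1 := by omega
  have h3 : i + (k + 1) - i = k + 1 := by omega
  rw [h1, h2, h3]
  rcases i with _ | i
  · simp
    ring
  · simp only [Nat.add_sub_cancel, Nat.succ_pos, if_true]
    have e1 : k + 2 - 1 = k + 1 := rfl
    rw [e1, Nat.choose_succ_succ (k + 1) (i + 1), Nat.choose_succ_succ k i]
    push_cast
    ring

lemma cheb_zero (n i : ℕ) (hn : 2 ≤ n) (h : n < 2 * i) : cheb n i = 0 := by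
  unfold cheb
  rw [Nat.choose_eq_zero_of_lt (by omega : n - i < i),
    Nat.choose_eq_zero_of_lt (by omega : n - i - 1 < i - 1)]
  simp

lemma cheb_frac (n i : ℕ) (h : i < n) : (cheb n i : ℝ) =
    (-1) ^ i * ((n : ℝ) / ((n : ℝ) - (i : ℝ))) * ((n - i).choose i : ℝ) := by
  obtain ⟨k, rfl⟩ : ∃ k, n = i + (k + 1) := ⟨n - i - 1, by omega⟩
  unfold cheb
  rw [show i + (k + 1) - i = k + 1 by omega]
  have hk : (k : ℝ) + 1 ≠ 0 := by positivity
  rcases i with _ | i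
  · simp
    field_simp
  · have h := Nat.add_one_mul_choose_eq k i
    have h' : ((k : ℝ) + 1) * (k.choose i) = ((k + 1).choose (i + 1)) * ((i : ℝ) + 1) := by
      exact_mod_cast h
    simp only [Nat.add_sub_cancel, Nat.succ_pos, if_true]
    push_cast
    rw [show (i : ℝ) + 1 + (k + 1) - (i + 1) = k + 1 by ring]
    field_simp
    linear_combination h'

/-- The summand. -/
noncomputable def chebTerm (n i : ℕ) : Polynomial ℝ :=
  C ((cheb n i : ℝ)) * X ^ i * (1 + X) ^ (n - 2 * i)

lemma chebTerm_rec (n i : ℕ) (hn : 1 ≤ n) (hi : i ≤ n / 2) :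
    chebTerm (n + 2) (i + 1) = (1 + X) * chebTerm (n + 1) (i + 1) - X * chebTerm n i := by
  obtain ⟨k, rfl⟩ : ∃ k, n = i + (k + 1) := ⟨n - i - 1, by omega⟩
  have hr := cheb_rec k i
  unfold chebTerm
  by_cases h : 2 * (i + 1) ≤ i + (k + 1) + 1
  · obtain ⟨m, hm⟩ : ∃ m, i + (k + 1) + 1 = 2 * (i + 1) + m := ⟨_, (Nat.add_sub_cancel' h).symm⟩
    rw [hr, show i + (k + 1) + 2 - 2 * (i + 1) = m + 1 by omega,
      show i + (k + 1) + 1 - 2 * (i + 1) = m by omega,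
      show i + (k + 1) - 2 * i = m + 1 by omega]
    push_cast
    rw [C_sub]
    ring
  · have hz := cheb_zero (i + (k + 1) + 1) (i + 1) (by omega) (by omega)
    rw [hr, hz, show i + (k + 1) + 2 - 2 * (i + 1) = 0 by omega,
      show i + (k + 1) - 2 * i = 0 by omega]
    simp
    ring

lemma cheb_at_zero (n : ℕ) : cheb n 0 = 1 := by simp [cheb]

lemma chebTerm_at_zero (n : ℕ) : chebTerm n 0 = (1 + X) ^ n := by
  simp [chebTerm, cheb_at_zero]

lemma cheb_sum (n : ℕ) : (1 : Polynomial ℝ) + X ^ (n + 1) =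
    ∑ i ∈ Finset.range ((n + 1) / 2 + 1), chebTerm (n + 1) i := by
  induction n using Nat.strong_induction_on with
  | _ n ih =>
    rcases n with _ | _ | n
    · simp [chebTerm_at_zero]
    · simp [Finset.sum_range_succ, chebTerm_at_zero]
      simp [chebTerm, cheb]
      rw [show (C 2 : Polynomial ℝ) = 2 from rfl]
      ring
    · have h0 := ih n (by omega)
      have h1 := ih (n + 1) (by omega)
      have h1' : (1 : Polynomial ℝ) + X ^ (n + 1 + 1) =
          ∑ i ∈ Finset.range ((n + 1) / 2 + 1 + 1), chebTerm (n + 1 + 1) i := by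
        rw [h1]
        rcases (by omega : (n + 1 + 1) / 2 + 1 = (n + 1) / 2 + 1 + 1 ∨
          ((n + 1 + 1) / 2 + 1 = (n + 1) / 2 + 1 ∧ n + 1 + 1 < 2 * ((n + 1) / 2 + 1)))
          with h | ⟨h, h'⟩
        · rw [h]
        · rw [h, Finset.sum_range_succ _ ((n + 1) / 2 + 1)]
          have hz : chebTerm (n + 1 + 1) ((n + 1) / 2 + 1) = 0 := by
            simp [chebTerm, cheb_zero _ _ (by omega : 2 ≤ n + 1 + 1) h']
          rw [hz, add_zero]
      rw [Finset.sum_range_succ', chebTerm_at_zero] at h1'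
      rw [show (n + 1 + 1 + 1) / 2 + 1 = (n + 1) / 2 + 1 + 1 by omega,
        Finset.sum_range_succ', chebTerm_at_zero]
      have hs : ∑ i ∈ Finset.range ((n + 1) / 2 + 1), chebTerm (n + 1 + 1 + 1) (i + 1) =
          ∑ i ∈ Finset.range ((n + 1) / 2 + 1),
            ((1 + X) * chebTerm (n + 1 + 1) (i + 1) - X * chebTerm (n + 1) i) := by
        refine Finset.sum_congr rfl fun i hi => ?_
        have := Finset.mem_range.mp hi
        exact chebTerm_rec (n + 1) i (by omega) (by omega)
      rw [hs, Finset.sum_sub_distrib, ← Finset.mul_sum, ← Finset.mul_sum, ← h0]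
      linear_combination (1 + X) * h1'

lemma Spoly_sum (m : ℕ) : Spoly m = ∑ i ∈ Finset.range (m / 2 + 1), chebTerm m i := by
  rcases m with _ | m
  · simp [Spoly, chebTerm_at_zero]
  · rw [← cheb_sum]
    simp [Spoly]

/-- `1 + q^n = Σ_{i=0}^{⌊n/2⌋} C(n,i) q^i (1+q)^{n-2i}` with
`C(n,i) = (-1)^i [binom(n-i,i) + binom(n-i-1,i-1)]`; this coefficient equals
`(-1)^i (n/(n-i)) binom(n-i,i)` whenever `i < n`; and consequently the
transition matrix `M(B,S)` from `{q^j (1+q)^{n-2j}}` to `{q^j S_{n-2j}}` is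
lower triangular with `(i,j)` entry `C(n-2j, i-j)`
`= (-1)^{i-j} ((n-2j)/(n-i-j)) binom(n-i-j, i-j)`. -/
theorem transition_B_to_S (n : ℕ) (hn : 1 ≤ n) :
    ((1 : Polynomial ℝ) + X ^ n =
        ∑ i ∈ Finset.range (n / 2 + 1),
          C ((cheb n i : ℝ)) * X ^ i * (1 + X) ^ (n - 2 * i)) ∧
    (∀ i < n, (cheb n i : ℝ) =
        (-1) ^ i * ((n : ℝ) / ((n : ℝ) - (i : ℝ))) * ((n - i).choose i : ℝ)) ∧
    (∀ j ≤ n / 2, Spoly (n - 2 * j) * X ^ j =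
        ∑ i ∈ Finset.Icc j (n / 2),
          C ((cheb (n - 2 * j) (i - j) : ℝ)) * X ^ i * (1 + X) ^ (n - 2 * i)) ∧
    (∀ i j : ℕ, j ≤ i → i + j < n →
        (cheb (n - 2 * j) (i - j) : ℝ) =
          (-1) ^ (i - j) * (((n : ℝ) - 2 * (j : ℝ)) / ((n : ℝ) - (i : ℝ) - (j : ℝ))) *
            ((n - i - j).choose (i - j) : ℝ)) := by
  refine ⟨?_, fun i hi => cheb_frac n i hi, ?_, ?_⟩
  · obtain ⟨m, rfl⟩ : ∃ m, n = m + 1 := ⟨n - 1, by omega⟩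
    exact cheb_sum m
  · intro j hj
    rw [Spoly_sum, Finset.sum_mul, ← Finset.Ico_add_one_right_eq_Icc,
      Finset.sum_Ico_eq_sum_range,
      show n / 2 + 1 - j = (n - 2 * j) / 2 + 1 by omega]
    refine Finset.sum_congr rfl fun i _ => ?_
    rw [chebTerm, Nat.add_sub_cancel_left, show n - 2 * (j + i) = n - 2 * j - 2 * i by omega]
    ring
  · intro i j hij h
    rw [cheb_frac _ _ (by omega), show n - 2 * j - (i - j) = n - i - j by omega,
      Nat.cast_sub (by omega : 2 * j ≤ n), Nat.cast_sub hij]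
    push_cast
    rw [show (n : ℝ) - 2 * j - (i - j) = n - i - j by ring]
end

section
/- Let f be a nonzero real polynomial with nonnegative coefficients that is palindromic of darga n. Then f is unimodal (i.e., its coefficient sequence a_0, a_1, …, a_n satisfies a_0 ≤ a_1 ≤ ⋯ ≤ a_m ≥ a_{m+1} ≥ ⋯ ≥ a_n for some m) if and only if there exist nonnegative real numbers c_0, …, c_{⌊n/2⌋} such that f(q) = Σ_{j=0}^{⌊n/2⌋} c_j q^j (1 + q + ⋯ + q^{n−2j}). -/
open Polynomial

/-- The coefficient sequence `a_0, …, a_n` of `f` is unimodal: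
`a_0 ≤ ⋯ ≤ a_m ≥ ⋯ ≥ a_n` for some `m`. -/
def UnimodalDarga (f : Polynomial ℝ) (n : ℕ) : Prop :=
  ∃ m ≤ n, (∀ i < m, f.coeff i ≤ f.coeff (i + 1)) ∧
    ∀ i, m ≤ i → i < n → f.coeff (i + 1) ≤ f.coeff i

theorem coeff_A (c : ℕ → ℝ) (n k : ℕ) :
    (∑ j ∈ Finset.range (n / 2 + 1),
      C (c j) * X ^ j * ∑ i ∈ Finset.range (n - 2 * j + 1), (X : ℝ[X]) ^ i).coeff k =
    ∑ j ∈ Finset.range (n / 2 + 1), if j ≤ k ∧ k + j ≤ n then c j else 0 := by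
  rw [finset_sum_coeff]
  refine Finset.sum_congr rfl fun j hj => ?_
  rw [Finset.mem_range] at hj
  rw [mul_assoc, coeff_C_mul, coeff_X_pow_mul', finset_sum_coeff]
  simp only [coeff_X_pow, Finset.sum_ite_eq, Finset.mem_range]
  split_ifs <;> first | omega | simp

theorem coeff_A_low (c : ℕ → ℝ) (n k : ℕ) (hk : k ≤ n / 2) :
    (∑ j ∈ Finset.range (n / 2 + 1), if j ≤ k ∧ k + j ≤ n then c j else 0) =
    ∑ j ∈ Finset.range (k + 1), c j := by
  rw [← Finset.sum_filter]
  refine Finset.sum_congr ?_ fun _ _ => rfl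
  ext j
  simp only [Finset.mem_filter, Finset.mem_range]
  omega

/-- a nonzero palindromic polynomial of darga `n` with nonnegative
coefficients is unimodal iff it is a nonnegative linear combination
`Σ_{j=0}^{⌊n/2⌋} c_j q^j (1 + q + ⋯ + q^{n-2j})`, i.e. iff it is A-positive. -/
theorem unimodal_iff_A_positive (f : Polynomial ℝ) (hf : f ≠ 0) (n : ℕ)
    (hcoeff : ∀ i, 0 ≤ f.coeff i) (hpal : PalinDarga f n) :
    UnimodalDarga f n ↔
      ∃ c : ℕ → ℝ, (∀ j, 0 ≤ c j) ∧
        f = ∑ j ∈ Finset.range (n / 2 + 1),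
          C (c j) * X ^ j * ∑ i ∈ Finset.range (n - 2 * j + 1), X ^ i := by
  obtain ⟨hdeg, hsym⟩ := hpal
  constructor
  · rintro ⟨m, hm, hup, hdown⟩
    have hmono : ∀ i, i + 1 ≤ n / 2 → f.coeff i ≤ f.coeff (i + 1) := by
      intro i hi
      by_cases him : i < m
      · exact hup i him
      · have h := hdown (n - (i + 1)) (by omega) (by omega)
        rw [hsym i (by omega), hsym (i + 1) (by omega)]
        have e : n - (i + 1) + 1 = n - i := by omega
        rwa [e] at h
    let c : ℕ → ℝ := fun j => if j ≤ n / 2 then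
      f.coeff j - (if j = 0 then 0 else f.coeff (j - 1)) else 0
    have hsum : ∀ k ≤ n / 2, ∑ j ∈ Finset.range (k + 1), c j = f.coeff k := by
      intro k
      induction k with
      | zero => intro _; simp [c]
      | succ k ih =>
        intro hk
        rw [Finset.sum_range_succ, ih (by omega)]
        simp [c, hk]
    refine ⟨c, ?_, ?_⟩
    · intro j
      simp only [c]
      split_ifs with h1 h2
      · simpa using hcoeff j
      · have h := hmono (j - 1) (by omega)
        rw [Nat.sub_add_cancel (by omega)] at h
        linarith
      · exact le_rfl
    · ext k
      rw [coeff_A]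
      by_cases hk : k ≤ n / 2
      · rw [coeff_A_low c n k hk, hsum k hk]
      by_cases hkn : k ≤ n
      · rw [hsym k hkn, ← hsum (n - k) (by omega), ← coeff_A_low c n (n - k) (by omega)]
        refine Finset.sum_congr rfl fun j _ => ?_
        congr 1
        apply propext
        omega
      · rw [coeff_eq_zero_of_natDegree_lt (by omega)]
        symm
        refine Finset.sum_eq_zero fun j _ => if_neg (by omega)
  · rintro ⟨c, hc, hfc⟩
    have hco : ∀ k, f.coeff k =
        ∑ j ∈ Finset.range (n / 2 + 1), if j ≤ k ∧ k + j ≤ n then c j else 0 := by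
      intro k
      rw [← coeff_A, ← hfc]
    refine ⟨n / 2, Nat.div_le_self _ _, ?_, ?_⟩
    · intro i hi
      rw [hco, hco, coeff_A_low c n i (by omega), coeff_A_low c n (i + 1) (by omega),
        Finset.sum_range_succ _ (i + 1)]
      linarith [hc (i + 1)]
    · intro i hi hin
      rw [hco, hco]
      refine Finset.sum_le_sum fun j hj => ?_
      rw [Finset.mem_range] at hj
      have := hc j
      split_ifs <;> first | omega | linarith
end

section
/- Let f(q) = Σ_{j=0}^n a_j q^j be a real polynomial palindromic of darga n, and suppose f(q) = Σ_{i=0}^{⌊n/2⌋} b_i q^i (1+q)^{n−2i} with b_i real. Then for each 0 ≤ i ≤ ⌊n/2⌋, b_i = Σ_{j=0}^{i} (−1)^{i−j} [ binomial(n−i−j, i−j) + binomial(n−i−j−1, i−j−1) ] a_j, where the bracketed coefficient equals ((n−2j)/(n−i−j)) binomial(n−i−j, i−j) when i + j < n. Moreover, if all a_j are integers then all b_i are integers. -/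
open Polynomial

lemma vand_aux (p d s : ℕ) :
    ∑ j ∈ Finset.range (s + 1), (-1 : ℤ) ^ (s - j) * ((d + (s - j)).choose (s - j) : ℤ) *
      ((p + d + 1).choose j : ℤ) = (p.choose s : ℤ) := by
  have h := Ring.add_choose_eq (R := ℤ) (r := ((p + d + 1 : ℕ) : ℤ)) (s := -((d + 1 : ℕ) : ℤ)) s
    (Commute.all _ _)
  have h0 : ((p + d + 1 : ℕ) : ℤ) + -((d + 1 : ℕ) : ℤ) = (p : ℕ) := by push_cast; ring
  rw [h0, Ring.choose_natCast, Finset.Nat.sum_antidiagonal_eq_sum_range_succ_mk] at h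
  push_cast at h ⊢
  rw [h]
  refine Finset.sum_congr rfl fun j hj => ?_
  have h1 := Ring.choose_neg (R := ℤ) ((d + 1 : ℕ) : ℤ) (s - j)
  have h2 : ((d + 1 : ℕ) : ℤ) + ((s - j : ℕ) : ℤ) - 1 = ((d + (s - j) : ℕ) : ℤ) := by
    push_cast; ring
  have h3 := Ring.choose_natCast (R := ℤ) (p + d + 1) j
  rw [h2, Ring.choose_natCast] at h1
  push_cast at h1 h3
  have h4 : ((-1 : ℤ) ^ (s - j)) = ((Int.negOnePow ((s - j : ℕ) : ℤ) : ℤˣ) : ℤ) := by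
    rw [Int.negOnePow_def]; simp
  rw [h1, h3, h4, Units.smul_def, smul_eq_mul]
  ring

noncomputable def wgt (n i j : ℕ) : ℝ :=
  (-1 : ℝ) ^ (i - j) *
          (((n - i - j).choose (i - j) : ℝ) +
            if j < i then ((n - i - j - 1).choose (i - j - 1) : ℝ) else 0)

lemma orth_aux (m r : ℕ) (h : 2 * r ≤ m) :
    ∑ j ∈ Finset.range (r + 1), wgt m r j * (m.choose j : ℝ) = if r = 0 then 1 else 0 := by
  rcases r with _ | r
  · simp [wgt]
  · obtain ⟨d, rfl⟩ := Nat.exists_eq_add_of_le h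
    have e1 := congrArg (Int.cast : ℤ → ℝ) (vand_aux (2 * r + 1) d (r + 1))
    have e2 := congrArg (Int.cast : ℤ → ℝ) (vand_aux (2 * r + 1) d r)
    have hs : (2 * r + 1).choose (r + 1) = (2 * r + 1).choose r :=
      Nat.choose_symm_of_eq_add (by omega)
    rw [hs, ← e2] at e1
    push_cast at e1
    rw [if_neg (by omega)]
    rw [Finset.sum_range_succ] at e1 ⊢
    have hm : 2 * (r + 1) + d = 2 * r + 1 + d + 1 := by omega
    have e3 : ∑ j ∈ Finset.range (r + 1), wgt (2 * (r + 1) + d) (r + 1) j *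
        ((2 * (r + 1) + d).choose j : ℝ) =
        ∑ j ∈ Finset.range (r + 1), ((-1 : ℝ) ^ (r + 1 - j) *
          ((d + (r + 1 - j)).choose (r + 1 - j) : ℝ) * ((2 * r + 1 + d + 1).choose j : ℝ)) -
        ∑ j ∈ Finset.range (r + 1), ((-1 : ℝ) ^ (r - j) *
          ((d + (r - j)).choose (r - j) : ℝ) * ((2 * r + 1 + d + 1).choose j : ℝ)) := by
      rw [← Finset.sum_sub_distrib]
      refine Finset.sum_congr rfl fun j hj => ?_
      have hj' : j < r + 1 := Finset.mem_range.1 hj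
      rw [wgt, if_pos hj', show 2 * (r + 1) + d - (r + 1) - j = d + (r + 1 - j) by omega,
        show d + (r + 1 - j) - 1 = d + (r - j) by omega, show r + 1 - j - 1 = r - j by omega, hm,
        show r + 1 - j = r - j + 1 by omega]
      ring
    rw [e3, hm]
    simp only [wgt, Nat.sub_self, pow_zero, Nat.choose_zero_right, lt_irrefl, if_false] at e1 ⊢
    push_cast at e1 ⊢
    linarith

lemma orth_shift (n i k : ℕ) (h : 2 * i ≤ n) :
    ∑ j ∈ Finset.range (i + 1), wgt n i j *
      (if k ≤ j then ((n - 2 * k).choose (j - k) : ℝ) else 0) = if k = i then 1 else 0 := by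
  by_cases hk : k ≤ i
  · obtain ⟨r, rfl⟩ := Nat.exists_eq_add_of_le hk
    rw [add_assoc, Finset.sum_range_add, Finset.sum_eq_zero, zero_add]
    · have := orth_aux (n - 2 * k) r (by omega)
      have e : (if k = k + r then (1 : ℝ) else 0) = if r = 0 then 1 else 0 := by
        congr 1; simp
      rw [e, ← this]
      refine Finset.sum_congr rfl fun j hj => ?_
      have hj' : j < r + 1 := Finset.mem_range.1 hj
      rw [if_pos (by omega), wgt, wgt, show k + r - (k + j) = r - j by omega,
        show n - (k + r) - (k + j) = n - 2 * k - r - j by omega,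
        show k + j - k = j by omega]
      simp only [add_lt_add_iff_left]
    · intro j hj
      have hj' : j < k := Finset.mem_range.1 hj
      rw [if_neg (by omega), mul_zero]
  · rw [if_neg (by omega)]
    refine Finset.sum_eq_zero fun j hj => ?_
    have hj' : j < i + 1 := Finset.mem_range.1 hj
    rw [if_neg (by omega), mul_zero]

lemma coeff_aux (n : ℕ) (b : ℕ → ℝ) (j : ℕ) :
    (∑ i ∈ Finset.range (n / 2 + 1), C (b i) * X ^ i * (1 + X) ^ (n - 2 * i)).coeff j =
    ∑ k ∈ Finset.range (n / 2 + 1), b k *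
      (if k ≤ j then ((n - 2 * k).choose (j - k) : ℝ) else 0) := by
  rw [finset_sum_coeff]
  refine Finset.sum_congr rfl fun k _ => ?_
  rw [mul_assoc, coeff_C_mul, coeff_X_pow_mul', coeff_one_add_X_pow]

lemma main_aux (n : ℕ) (b : ℕ → ℝ) (f : Polynomial ℝ)
    (hb : f = ∑ i ∈ Finset.range (n / 2 + 1), C (b i) * X ^ i * (1 + X) ^ (n - 2 * i))
    (i : ℕ) (hi : i ≤ n / 2) :
    b i = ∑ j ∈ Finset.range (i + 1), wgt n i j * f.coeff j := by
  have e : ∀ j, f.coeff j = ∑ k ∈ Finset.range (n / 2 + 1), b k *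
      (if k ≤ j then ((n - 2 * k).choose (j - k) : ℝ) else 0) := fun j => by
    rw [hb, coeff_aux]
  simp only [e, Finset.mul_sum]
  rw [Finset.sum_comm]
  have e2 : ∀ k, ∑ j ∈ Finset.range (i + 1), wgt n i j * (b k *
      (if k ≤ j then ((n - 2 * k).choose (j - k) : ℝ) else 0)) =
      b k * if k = i then 1 else 0 := fun k => by
    rw [← orth_shift n i k (by omega), Finset.mul_sum]
    exact Finset.sum_congr rfl fun j _ => by ring
  simp only [e2]
  simp
  omega

lemma bracket_aux (n i j : ℕ) (hji : j ≤ i) (hn : i + j < n) :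
    (((n - i - j).choose (i - j) : ℝ) +
            if j < i then ((n - i - j - 1).choose (i - j - 1) : ℝ) else 0) =
          (((n : ℝ) - 2 * (j : ℝ)) / ((n : ℝ) - (i : ℝ) - (j : ℝ))) *
            ((n - i - j).choose (i - j) : ℝ) := by
  obtain ⟨k, rfl⟩ := Nat.exists_eq_add_of_le hji
  obtain ⟨N, rfl⟩ := Nat.exists_eq_add_of_lt hn
  have hN : (N : ℝ) + 1 ≠ 0 := by positivity
  rw [show j + k + j + N + 1 - (j + k) - j = N + 1 by omega, show j + k - j = k by omega]
  have hd : ((j + k + j + N + 1 : ℕ) : ℝ) - ((j + k : ℕ) : ℝ) - (j : ℝ) = N + 1 := by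
    push_cast; ring
  have hu : ((j + k + j + N + 1 : ℕ) : ℝ) - 2 * (j : ℝ) = N + 1 + k := by
    push_cast; ring
  rw [hd, hu]
  rcases k with _ | k
  · simp [hN]
  · rw [if_pos (by omega)]
    have := congrArg (Nat.cast : ℕ → ℝ) (Nat.add_one_mul_choose_eq N k)
    simp only [Nat.add_sub_cancel]
    push_cast at this ⊢
    field_simp
    linarith

/-- if `f = Σ_j a_j q^j` is palindromic of darga `n` and
`f = Σ_{i=0}^{⌊n/2⌋} b_i q^i (1+q)^{n-2i}`, then for `0 ≤ i ≤ ⌊n/2⌋`,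
`b_i = Σ_{j=0}^{i} (-1)^{i-j} [binom(n-i-j, i-j) + binom(n-i-j-1, i-j-1)] a_j`
(with `binom(n-i-j-1, i-j-1) = 0` when `j = i`); the bracketed coefficient
equals `((n-2j)/(n-i-j)) binom(n-i-j, i-j)` when `i + j < n`; and if all `a_j`
are integers then so are all `b_i`. -/
theorem B_expansion_coefficients (n : ℕ) (f : Polynomial ℝ)
    (hpal : PalinDarga f n) (b : ℕ → ℝ)
    (hb : f = ∑ i ∈ Finset.range (n / 2 + 1), C (b i) * X ^ i * (1 + X) ^ (n - 2 * i)) :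
    (∀ i ≤ n / 2, b i = ∑ j ∈ Finset.range (i + 1),
        (-1 : ℝ) ^ (i - j) *
          (((n - i - j).choose (i - j) : ℝ) +
            if j < i then ((n - i - j - 1).choose (i - j - 1) : ℝ) else 0) *
          f.coeff j) ∧
    (∀ i j : ℕ, j ≤ i → i + j < n →
        (((n - i - j).choose (i - j) : ℝ) +
            if j < i then ((n - i - j - 1).choose (i - j - 1) : ℝ) else 0) =
          (((n : ℝ) - 2 * (j : ℝ)) / ((n : ℝ) - (i : ℝ) - (j : ℝ))) *
            ((n - i - j).choose (i - j) : ℝ)) ∧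
    ((∀ j, ∃ z : ℤ, f.coeff j = (z : ℝ)) → ∀ i ≤ n / 2, ∃ z : ℤ, b i = (z : ℝ)) := by
  refine ⟨fun i hi => main_aux n b f hb i hi, fun i j => bracket_aux n i j, fun hz i hi => ?_⟩
  choose z hz using hz
  refine ⟨∑ j ∈ Finset.range (i + 1), (-1 : ℤ) ^ (i - j) *
          (((n - i - j).choose (i - j) : ℤ) +
            if j < i then ((n - i - j - 1).choose (i - j - 1) : ℤ) else 0) * z j, ?_⟩
  rw [main_aux n b f hb i hi]
  push_cast
  refine Finset.sum_congr rfl fun j _ => ?_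
  rw [hz, wgt]
end

section
/- Let f(q) = Σ_{j=0}^n a_j q^j be a real polynomial palindromic of darga n. Then f can be written as Σ_{i=0}^{⌊n/2⌋} b_i q^i (1+q)^{n−2i} with all b_i ≥ 0 (i.e., f is B-positive, equivalently f has nonnegative γ-vector) if and only if Σ_{j=0}^{i} (−1)^{i−j} [ binomial(n−i−j, i−j) + binomial(n−i−j−1, i−j−1) ] a_j ≥ 0 for every 0 ≤ i ≤ ⌊n/2⌋. -/
open Polynomial

noncomputable def tU (m i : ℕ) : ℝ[X] :=
  C ((-1 : ℝ) ^ i * ((m - i).choose i : ℝ)) * X ^ i * (1 + X) ^ (m - 2 * i)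

lemma tU_rec (m i : ℕ) : tU (m + 2) (i + 1) = (1 + X) * tU (m + 1) (i + 1) - X * tU m i := by
  unfold tU
  have e1 : m + 2 - (i + 1) = m + 1 - i := by omega
  have e2 : m + 1 - (i + 1) = m - i := by omega
  have e3 : m + 2 - 2 * (i + 1) = m - 2 * i := by omega
  have hc : ((m + 1 - i).choose (i + 1)) = (m - i).choose i + (m - i).choose (i + 1) := by
    rcases Nat.lt_or_ge m i with h | h
    · have a : m + 1 - i = 0 := by omega
      have b : m - i = 0 := by omega
      rw [a, b]
      obtain ⟨k, rfl⟩ : ∃ k, i = k + 1 := ⟨i - 1, by omega⟩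
      simp
    · have a : m + 1 - i = (m - i) + 1 := by omega
      rw [a, Nat.choose_succ_succ]
  rw [e1, e2, e3, hc]
  rcases Nat.lt_or_ge m (2 * i + 1) with h | h
  · have : (m - i).choose (i + 1) = 0 := Nat.choose_eq_zero_of_lt (by omega)
    rw [this]
    simp only [Nat.add_zero, Nat.cast_zero, mul_zero, map_zero, zero_mul, pow_succ, map_mul,
      map_neg, map_one, mul_neg, neg_mul, mul_one]
    ring
  · have : m - 2 * i = (m + 1 - 2 * (i + 1)) + 1 := by omega
    rw [this]
    simp only [pow_succ, map_mul, Nat.cast_add, map_add,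
      map_neg, map_one, mul_neg, neg_mul, mul_one]
    ring

lemma tU_zero (m i : ℕ) (h : m / 2 < i) : tU m i = 0 := by
  unfold tU
  rw [Nat.choose_eq_zero_of_lt (by omega)]
  simp

lemma U_eq (m : ℕ) : ∀ N, m / 2 < N →
    ∑ i ∈ Finset.range N, tU m i = ∑ k ∈ Finset.range (m + 1), (X : ℝ[X]) ^ k := by
  induction m using Nat.twoStepInduction with
  | zero =>
    intro N hN
    obtain ⟨k, rfl⟩ : ∃ k, N = k + 1 := ⟨N - 1, by omega⟩
    rw [Finset.sum_range_succ', Finset.sum_eq_zero (fun i _ => tU_zero _ _ (by omega))]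
    simp [tU]
  | one =>
    intro N hN
    obtain ⟨k, rfl⟩ : ∃ k, N = k + 1 := ⟨N - 1, by omega⟩
    rw [Finset.sum_range_succ', Finset.sum_eq_zero (fun i _ => tU_zero _ _ (by omega))]
    simp [tU, Finset.sum_range_succ]
  | more m ih0 ih1 =>
    intro N hN
    obtain ⟨k, rfl⟩ : ∃ k, N = k + 1 := ⟨N - 1, by omega⟩
    have h1 := ih1 (k + 1) (by omega)
    have h0 := ih0 k (by omega)
    rw [Finset.sum_range_succ'] at h1 ⊢
    simp only [tU_rec]
    rw [Finset.sum_sub_distrib, ← Finset.mul_sum, ← Finset.mul_sum, h0]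
    have hz : tU (m + 2) 0 = (1 + X) * tU (m + 1) 0 := by
      simp [tU]; ring
    rw [hz]
    have e : ∀ a b c d : ℝ[X], a * b - c + a * d = a * (b + d) - c := by intros; ring
    rw [e, h1, Finset.sum_range_succ _ (m + 2), Finset.sum_range_succ _ (m + 1)]
    have := Finset.sum_range_succ' (fun k => (X : ℝ[X]) ^ k) (m + 1)
    rw [Finset.sum_range_succ] at this
    have h2 : ∑ k ∈ Finset.range (m + 1), (X : ℝ[X]) ^ (k + 1)
        = X * ∑ k ∈ Finset.range (m + 1), (X : ℝ[X]) ^ k := by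
      rw [Finset.mul_sum]; exact Finset.sum_congr rfl (fun _ _ => by ring)
    rw [h2] at this
    simp only [pow_zero] at this
    ring_nf at this ⊢

noncomputable def KK (n i j : ℕ) : ℝ :=
  (-1 : ℝ) ^ (i - j) *
            (((n - i - j).choose (i - j) : ℝ) +
              if j < i then ((n - i - j - 1).choose (i - j - 1) : ℝ) else 0)

lemma KK_succ (n i j : ℕ) : KK (n + 2) (i + 1) (j + 1) = KK n i j := by
  unfold KK
  have e1 : n + 2 - (i + 1) - (j + 1) = n - i - j := by omega
  have e2 : i + 1 - (j + 1) = i - j := by omega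
  rw [e1, e2]
  simp

lemma lucas (m : ℕ) : ∑ i ∈ Finset.range ((m + 2) / 2 + 1),
    C (KK (m + 2) i 0) * X ^ i * (1 + X) ^ (m + 2 - 2 * i) = (1 + X ^ (m + 2) : ℝ[X]) := by
  have hd : (m + 2) / 2 = m / 2 + 1 := by omega
  have h2 := U_eq (m + 2) (m / 2 + 1 + 1) (by omega)
  have h0 := U_eq m (m / 2 + 1) (by omega)
  have key : ∀ i, C (KK (m + 2) (i + 1) 0) * X ^ (i + 1) * (1 + X) ^ (m + 2 - 2 * (i + 1))
      = tU (m + 2) (i + 1) - X * tU m i := by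
    intro i
    unfold KK tU
    have e1 : m + 2 - (i + 1) - 0 - 1 = m - i := by omega
    have e3 : m + 2 - 2 * (i + 1) = m - 2 * i := by omega
    rw [e1, e3]
    simp only [Nat.sub_zero, Nat.succ_pos, if_true, Nat.add_sub_cancel, mul_add, map_add, map_mul,
      pow_succ, map_neg, map_one, mul_neg, neg_mul, mul_one]
    ring
  have k0 : C (KK (m + 2) 0 0) * X ^ 0 * (1 + X) ^ (m + 2 - 2 * 0) = tU (m + 2) 0 := by
    simp [KK, tU]
  rw [hd, Finset.sum_range_succ', k0]
  simp only [key]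
  rw [Finset.sum_range_succ'] at h2
  rw [Finset.sum_sub_distrib, ← Finset.mul_sum, h0]
  have e : ∀ a b c : ℝ[X], a - b + c = (a + c) - b := by intros; ring
  rw [e, h2, Finset.sum_range_succ, Finset.sum_range_succ', Finset.mul_sum]
  have : ∀ k : ℕ, (X : ℝ[X]) ^ (k + 1) = X * X ^ k := fun k => by ring
  simp only [this]
  ring

noncomputable def LL (n : ℕ) (f : ℝ[X]) (i : ℕ) : ℝ :=
  ∑ j ∈ Finset.range (i + 1), KK n i j * f.coeff j

lemma expand (n : ℕ) : ∀ f : ℝ[X], PalinDarga f n →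
    f = ∑ i ∈ Finset.range (n / 2 + 1), C (LL n f i) * X ^ i * (1 + X) ^ (n - 2 * i) := by
  induction n using Nat.twoStepInduction with
  | zero =>
    intro f hf
    have := eq_C_of_natDegree_le_zero hf.1
    simpa [LL, KK] using this
  | one =>
    intro f hf
    have h := eq_X_add_C_of_natDegree_le_one hf.1
    have h1 := hf.2 0 (by omega)
    simp only [Nat.sub_zero] at h1
    simp only [LL, KK]
    simp
    rw [← h1] at h
    conv_lhs => rw [h]
    ring
  | more n ih _ =>
    intro f hf
    obtain ⟨hdeg, hp⟩ := hf
    rw [natDegree_le_iff_coeff_eq_zero] at hdeg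
    set a := f.coeff 0 with ha
    set g := divX (f - C a * (1 + X ^ (n + 2))) with hg
    have hgc : ∀ j, g.coeff j = f.coeff (j + 1) - if j = n + 1 then a else 0 := by
      intro j
      simp only [hg, coeff_divX, coeff_sub, coeff_C_mul, coeff_add, coeff_X_pow, coeff_one]
      simp
    have hfg : f = X * g + C a * (1 + X ^ (n + 2)) := by
      have h := X_mul_divX_add (f - C a * (1 + X ^ (n + 2)))
      have h0 : (f - C a * (1 + X ^ (n + 2))).coeff 0 = 0 := by
        simp [ha]
      rw [h0, map_zero, add_zero, ← hg] at h
      rw [h]; ring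
    have hgp : PalinDarga g n := by
      constructor
      · rw [natDegree_le_iff_coeff_eq_zero]
        intro N hN
        rw [hgc]
        split_ifs with h
        · subst h
          have := hp 0 (by omega)
          simp only [Nat.sub_zero] at this
          rw [ha, this]; simp
        · rw [hdeg _ (by omega)]; simp
      · intro i hi
        rw [hgc, hgc, if_neg (by omega), if_neg (by omega), hp (i + 1) (by omega)]
        congr 2; omega
    have hL : ∀ i ≤ n / 2, LL (n + 2) f (i + 1) = LL n g i + KK (n + 2) (i + 1) 0 * a := by
      intro i hi
      unfold LL
      rw [Finset.sum_range_succ']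
      congr 1
      apply Finset.sum_congr rfl
      intro j hj
      rw [Finset.mem_range] at hj
      rw [KK_succ, hgc, if_neg (by omega), sub_zero]
    have hL0 : LL (n + 2) f 0 = KK (n + 2) 0 0 * a := by simp [LL, ha]
    have hd : (n + 2) / 2 = n / 2 + 1 := by omega
    have hl := lucas n
    rw [hd, Finset.sum_range_succ'] at hl ⊢
    have hs : ∑ i ∈ Finset.range (n / 2 + 1),
        C (LL (n + 2) f (i + 1)) * X ^ (i + 1) * (1 + X) ^ (n + 2 - 2 * (i + 1))
        = X * g + C a * ∑ i ∈ Finset.range (n / 2 + 1),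
        C (KK (n + 2) (i + 1) 0) * X ^ (i + 1) * (1 + X) ^ (n + 2 - 2 * (i + 1)) := by
      conv_rhs => rw [ih g hgp]
      rw [Finset.mul_sum, Finset.mul_sum, ← Finset.sum_add_distrib]
      apply Finset.sum_congr rfl
      intro i hi
      rw [Finset.mem_range] at hi
      have e3 : n + 2 - 2 * (i + 1) = n - 2 * i := by omega
      rw [hL i (by omega), e3, map_add, map_mul]
      ring
    rw [hs, hL0]
    conv_lhs => rw [hfg, ← hl]
    rw [map_mul]
    ring

lemma uniq (n : ℕ) (b c : ℕ → ℝ)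
    (h : ∑ i ∈ Finset.range (n / 2 + 1), C (b i) * X ^ i * (1 + X) ^ (n - 2 * i) =
      ∑ i ∈ Finset.range (n / 2 + 1), C (c i) * X ^ i * (1 + X) ^ (n - 2 * i)) :
    ∀ i ≤ n / 2, b i = c i := by
  intro i
  induction i using Nat.strong_induction_on with
  | _ i ih =>
    intro hi
    have h1 := congrArg (fun p => coeff p i) h
    simp only [finsetSum_coeff] at h1
    rw [← sub_eq_zero, ← Finset.sum_sub_distrib, Finset.sum_eq_single i] at h1
    · simp only [mul_assoc, coeff_C_mul, coeff_X_pow_mul', le_refl, if_true, Nat.sub_self] at h1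
      have : ((1 + X : ℝ[X]) ^ (n - 2 * i)).coeff 0 = 1 := by
        simp [coeff_zero_eq_eval_zero]
      rw [this] at h1
      linarith
    · intro k hk hki
      rw [Finset.mem_range] at hk
      rcases Nat.lt_or_gt_of_ne hki with hlt | hgt
      · rw [ih k hlt (by omega), sub_self]
      · simp only [mul_assoc, coeff_C_mul, coeff_X_pow_mul', if_neg (not_le.mpr hgt)]
        simp
    · intro hk
      exact absurd (Finset.mem_range.mpr (by omega)) hk

/-- a polynomial `f = Σ_j a_j q^j` palindromic of darga `n` is
B-positive (i.e. `f = Σ_{i=0}^{⌊n/2⌋} b_i q^i (1+q)^{n-2i}` with all `b_i ≥ 0`,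
equivalently has nonnegative γ-vector) iff
`Σ_{j=0}^{i} (-1)^{i-j} [binom(n-i-j, i-j) + binom(n-i-j-1, i-j-1)] a_j ≥ 0`
for every `0 ≤ i ≤ ⌊n/2⌋`. -/
theorem B_positive_iff (n : ℕ) (f : Polynomial ℝ) (hpal : PalinDarga f n) :
    (∃ b : ℕ → ℝ, (∀ i ≤ n / 2, 0 ≤ b i) ∧
        f = ∑ i ∈ Finset.range (n / 2 + 1), C (b i) * X ^ i * (1 + X) ^ (n - 2 * i)) ↔
      ∀ i ≤ n / 2,
        0 ≤ ∑ j ∈ Finset.range (i + 1),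
          (-1 : ℝ) ^ (i - j) *
            (((n - i - j).choose (i - j) : ℝ) +
              if j < i then ((n - i - j - 1).choose (i - j - 1) : ℝ) else 0) *
            f.coeff j := by
  constructor
  · rintro ⟨b, hb, hf⟩ i hi
    have h := uniq n b (LL n f) (hf ▸ expand n f hpal) i hi
    have h2 := hb i hi
    rw [h] at h2
    exact h2
  · intro h
    exact ⟨LL n f, h, expand n f hpal⟩
end

section
/- For all natural numbers i and j, the polynomial identity (1 + q + ⋯ + q^i)(1 + q + ⋯ + q^j) = Σ_{k=0}^{min(i,j)} q^k (1 + q + ⋯ + q^{i+j−2k}) holds in ℝ[q]. In particular, the product A_i(q)·A_j(q), where A_k(q) = 1 + q + ⋯ + q^k, is a nonnegative linear combination of the basis elements q^k A_{i+j−2k}(q) of P_{i+j}, so the sequence (A_j)_{j≥0} is self-positive. -/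
open Polynomial

/-- The basic palindromic polynomials `A_k = 1 + q + ⋯ + q^k`. -/
noncomputable def Apoly : ℕ → Polynomial ℝ := fun k => ∑ i ∈ Finset.range (k + 1), X ^ i

theorem Apoly_mul_sub (k : ℕ) : Apoly k * (X - 1) = X ^ (k + 1) - 1 :=
  geom_sum_mul (X : Polynomial ℝ) (k + 1)

theorem Apoly_step (m n : ℕ) :
    Apoly (m + 1) * Apoly (n + 1) = Apoly (m + n + 2) + X * (Apoly m * Apoly n) := by
  have hX : (X - 1 : Polynomial ℝ) ≠ 0 := by
    simpa using X_sub_C_ne_zero (1 : ℝ)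
  have h1 := Apoly_mul_sub m
  have h2 := Apoly_mul_sub n
  have h3 := Apoly_mul_sub (m + 1)
  have h4 := Apoly_mul_sub (n + 1)
  have h5 := Apoly_mul_sub (m + n + 2)
  apply mul_right_cancel₀ (mul_ne_zero hX hX)
  calc Apoly (m + 1) * Apoly (n + 1) * ((X - 1) * (X - 1))
      = (Apoly (m + 1) * (X - 1)) * (Apoly (n + 1) * (X - 1)) := by ring
    _ = (Apoly (m + n + 2) * (X - 1)) * (X - 1)
        + X * ((Apoly m * (X - 1)) * (Apoly n * (X - 1))) := by
      rw [h1, h2, h3, h4, h5]; ring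
    _ = _ := by ring

theorem Apoly_mul_eq (i : ℕ) : ∀ j : ℕ,
    Apoly i * Apoly j =
      ∑ k ∈ Finset.range (min i j + 1), X ^ k * Apoly (i + j - 2 * k) := by
  induction i with
  | zero => intro j; simp [Apoly]
  | succ m ih =>
    intro j
    cases j with
    | zero => simp [Apoly]
    | succ n =>
      rw [Apoly_step, ih n, Nat.succ_min_succ, Finset.mul_sum, Finset.sum_range_succ' _ ((min m n).succ)]
      refine (add_comm _ _).trans (congrArg₂ (· + ·) ?_ ?_)
      · apply Finset.sum_congr rfl
        intro k _
        rw [show m + 1 + (n + 1) - 2 * (k + 1) = m + n - 2 * k by omega]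
        ring
      · rw [show m + 1 + (n + 1) - 2 * 0 = m + n + 2 by omega]
        simp

/-- `A_i · A_j = Σ_{k=0}^{min(i,j)} q^k A_{i+j-2k}`; in particular
the product `A_i · A_j` is a nonnegative linear combination of the polynomials
`q^k A_{i+j-2k}`, `0 ≤ k ≤ ⌊(i+j)/2⌋`, so the sequence `(A_j)` is self-positive. -/
theorem Apoly_mul_self_positive (i j : ℕ) :
    Apoly i * Apoly j = ∑ k ∈ Finset.range (min i j + 1), X ^ k * Apoly (i + j - 2 * k) ∧
    ∃ a : ℕ → ℝ, (∀ k, 0 ≤ a k) ∧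
      Apoly i * Apoly j =
        ∑ k ∈ Finset.range ((i + j) / 2 + 1), C (a k) * X ^ k * Apoly (i + j - 2 * k) := by
  refine ⟨Apoly_mul_eq i j, fun k => if k < min i j + 1 then 1 else 0, ?_, ?_⟩
  · intro k
    dsimp only
    split_ifs <;> norm_num
  · rw [Apoly_mul_eq]
    have hsub : Finset.range (min i j + 1) ⊆ Finset.range ((i + j) / 2 + 1) := by
      intro k hk
      rw [Finset.mem_range] at hk ⊢
      omega
    rw [← Finset.sum_subset hsub]
    · apply Finset.sum_congr rfl
      intro k hk
      beta_reduce
      rw [if_pos (Finset.mem_range.1 hk)]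
      simp
    · intro k _ hk
      beta_reduce
      rw [if_neg (fun h => hk (Finset.mem_range.2 h))]
      simp
end

section
/- Let f be a real polynomial with nonnegative coefficients that is palindromic of darga n and unimodal, and let g be a real polynomial with nonnegative coefficients that is palindromic of darga m and unimodal. Then the product f·g has nonnegative coefficients, is palindromic of darga n + m, and is unimodal; that is, the product of Λ-polynomials is a Λ-polynomial. -/
open Polynomial

/-- Coefficients extended by zero to the integers. -/
noncomputable def zcoeff (f : Polynomial ℝ) (i : ℤ) : ℝ :=
  if 0 ≤ i then f.coeff i.toNat else 0

lemma zcoeff_natCast (f : Polynomial ℝ) (i : ℕ) : zcoeff f i = f.coeff i := by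
  simp [zcoeff]

lemma zcoeff_neg (f : Polynomial ℝ) (i : ℤ) (h : i < 0) : zcoeff f i = 0 := by
  simp [zcoeff, h]

lemma zcoeff_symm (f : Polynomial ℝ) (n : ℕ) (hp : PalinDarga f n) (i : ℤ) :
    zcoeff f (n - i) = zcoeff f i := by
  by_cases h0 : i < 0
  · rw [zcoeff_neg f i h0, zcoeff, if_pos (by omega)]
    apply coeff_eq_zero_of_natDegree_lt
    have := hp.1
    omega
  · obtain ⟨j, rfl⟩ := Int.eq_ofNat_of_zero_le (not_lt.mp h0)
    by_cases h1 : j ≤ n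
    · rw [← Nat.cast_sub h1, zcoeff_natCast, zcoeff_natCast]
      exact (hp.2 j h1).symm
    · rw [zcoeff_neg _ _ (by omega), zcoeff_natCast]
      symm
      apply coeff_eq_zero_of_natDegree_lt
      have := hp.1
      omega

lemma zcoeff_le (f : Polynomial ℝ) (n : ℕ) (hc : ∀ i, 0 ≤ f.coeff i)
    (hp : PalinDarga f n) (hu : UnimodalDarga f n) (x y : ℤ) (hxy : y ≤ x)
    (hs : x + y ≤ n) : zcoeff f y ≤ zcoeff f x := by
  by_cases hy : y < 0
  · rw [zcoeff_neg f y hy, zcoeff]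
    split_ifs
    · exact hc _
    · exact le_rfl
  obtain ⟨y, rfl⟩ := Int.eq_ofNat_of_zero_le (not_lt.mp hy)
  obtain ⟨x, rfl⟩ := Int.eq_ofNat_of_zero_le (le_trans (not_lt.mp hy) hxy)
  rw [zcoeff_natCast, zcoeff_natCast]
  have hxy' : y ≤ x := by exact_mod_cast hxy
  have hs' : x + y ≤ n := by exact_mod_cast hs
  obtain ⟨p, hpn, h1, h2⟩ := hu
  have mono : ∀ b, y ≤ b → b ≤ p → f.coeff y ≤ f.coeff b := by
    intro b hb
    induction b, hb using Nat.le_induction with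
    | base => intro _; exact le_rfl
    | succ b hb ih => intro h; exact (ih (by omega)).trans (h1 b (by omega))
  have anti : p ≤ x → ∀ b, x ≤ b → b ≤ n → f.coeff b ≤ f.coeff x := by
    intro hpx b hb
    induction b, hb using Nat.le_induction with
    | base => intro _; exact le_rfl
    | succ b hb ih => intro h; exact (h2 b (by omega) (by omega)).trans (ih (by omega))
  rcases le_total x p with h | h
  · exact mono x hxy' h
  · rw [hp.2 y (by omega)]
    exact anti h _ (by omega) (by omega)

lemma coeff_mul_zcoeff (f h : Polynomial ℝ) (N : ℕ) (hN : h.natDegree < N) (k : ℕ) :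
    (f * h).coeff k = ∑ j ∈ Finset.range N, zcoeff f ((k : ℤ) - j) * h.coeff j := by
  conv_lhs => rw [h.as_sum_range' N hN]
  rw [Finset.mul_sum, finsetSum_coeff]
  refine Finset.sum_congr rfl fun j _ => ?_
  rw [← C_mul_X_pow_eq_monomial, ← mul_assoc, coeff_mul_X_pow', coeff_mul_C]
  split_ifs with hj
  · rw [← Nat.cast_sub hj, zcoeff_natCast]
  · rw [zcoeff_neg _ _ (by omega), zero_mul]

lemma coeff_step (f g : Polynomial ℝ) (n m : ℕ)
    (hfc : ∀ i, 0 ≤ f.coeff i) (hfp : PalinDarga f n) (hfu : UnimodalDarga f n)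
    (hgc : ∀ i, 0 ≤ g.coeff i) (hgp : PalinDarga g m) (hgu : UnimodalDarga g m)
    (k : ℕ) (hk : 2 * k + 1 ≤ n + m) : (f * g).coeff k ≤ (f * g).coeff (k + 1) := by
  have hdeg : (g * (1 - X)).natDegree < m + 2 := by
    have h1 : (g * (1 - X)).natDegree ≤ g.natDegree + (1 - X : Polynomial ℝ).natDegree :=
      natDegree_mul_le
    have h2 : (1 - X : Polynomial ℝ).natDegree ≤ 1 := by compute_degree
    have := hgp.1
    omega
  have hD : ∀ j : ℕ, (g * (1 - X)).coeff j = zcoeff g j - zcoeff g ((j : ℤ) - 1) := by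
    intro j
    rw [mul_sub, mul_one, coeff_sub, zcoeff_natCast]
    congr 1
    cases j with
    | zero => rw [zcoeff_neg _ _ (by simp)]; simp
    | succ j =>
      rw [coeff_mul_X, ← zcoeff_natCast]
      congr 1
      push_cast
      ring
  have key := coeff_mul_zcoeff f (g * (1 - X)) (m + 2) hdeg (k + 1)
  have hl : (f * (g * (1 - X))).coeff (k + 1) = (f * g).coeff (k + 1) - (f * g).coeff k := by
    rw [← mul_assoc, mul_sub, mul_one, coeff_sub, coeff_mul_X]
  rw [hl] at key
  have key2 := key
  rw [← Finset.sum_range_reflect] at key2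
  have hsum : 0 ≤ ((f * g).coeff (k + 1) - (f * g).coeff k) +
      ((f * g).coeff (k + 1) - (f * g).coeff k) := by
    nth_rewrite 1 [key]
    rw [key2, ← Finset.sum_add_distrib]
    refine Finset.sum_nonneg fun j hj => ?_
    have hj' : j < m + 2 := Finset.mem_range.mp hj
    rw [hD, hD]
    have e : ((m + 2 - 1 - j : ℕ) : ℤ) = m + 1 - j := by omega
    rw [e]
    have s1 : zcoeff g ((m : ℤ) + 1 - j) = zcoeff g ((j : ℤ) - 1) := by
      rw [← zcoeff_symm g m hgp]; congr 1; ring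
    have s2 : zcoeff g ((m : ℤ) + 1 - j - 1) = zcoeff g (j : ℤ) := by
      rw [← zcoeff_symm g m hgp]; congr 1; ring
    rw [s1, s2]
    have fin : 0 ≤ (zcoeff f (((k + 1 : ℕ) : ℤ) - j) -
        zcoeff f (((k + 1 : ℕ) : ℤ) - (m + 1 - j))) *
        (zcoeff g j - zcoeff g ((j : ℤ) - 1)) := by
      rcases le_total (2 * j) (m + 1) with h | h
      · apply mul_nonneg
        · exact sub_nonneg.mpr (zcoeff_le f n hfc hfp hfu _ _ (by omega) (by omega))
        · exact sub_nonneg.mpr (zcoeff_le g m hgc hgp hgu _ _ (by omega) (by omega))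
      · apply mul_nonneg_of_nonpos_of_nonpos
        · exact sub_nonpos.mpr (zcoeff_le f n hfc hfp hfu _ _ (by omega) (by omega))
        · rw [← s1, ← s2]
          exact sub_nonpos.mpr (zcoeff_le g m hgc hgp hgu _ _ (by omega) (by omega))
    linarith
  linarith

lemma palin_reflect (f : Polynomial ℝ) (n : ℕ) (hp : PalinDarga f n) : reflect n f = f := by
  ext i
  rw [coeff_reflect]
  by_cases h : i ≤ n
  · rw [revAt_le h]; exact (hp.2 i h).symm
  · rw [revAt_eq_self_of_lt (by omega)]

/-- the product of Λ-polynomials is a Λ-polynomial: if `f` has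
nonnegative coefficients and is palindromic of darga `n` and unimodal, and `g`
has nonnegative coefficients and is palindromic of darga `m` and unimodal, then
`f * g` has nonnegative coefficients, is palindromic of darga `n + m`, and is
unimodal. -/
theorem lambda_mul_lambda (f g : Polynomial ℝ) (n m : ℕ)
    (hfc : ∀ i, 0 ≤ f.coeff i) (hfp : PalinDarga f n) (hfu : UnimodalDarga f n)
    (hgc : ∀ i, 0 ≤ g.coeff i) (hgp : PalinDarga g m) (hgu : UnimodalDarga g m) :
    (∀ i, 0 ≤ (f * g).coeff i) ∧ PalinDarga (f * g) (n + m) ∧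
      UnimodalDarga (f * g) (n + m) := by
  have hpal : PalinDarga (f * g) (n + m) := by
    refine ⟨natDegree_mul_le.trans (add_le_add hfp.1 hgp.1), fun i hi => ?_⟩
    have h := reflect_mul f g hfp.1 hgp.1
    rw [palin_reflect f n hfp, palin_reflect g m hgp] at h
    conv_lhs => rw [← h]
    rw [coeff_reflect, revAt_le hi]
  have step := coeff_step f g n m hfc hfp hfu hgc hgp hgu
  refine ⟨fun i => ?_, hpal, (n + m) / 2, by omega, fun i hi => step i (by omega), ?_⟩
  · rw [coeff_mul]
    exact Finset.sum_nonneg fun x _ => mul_nonneg (hfc _) (hgc _)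
  · intro i h1 h2
    rw [hpal.2 (i + 1) (by omega), hpal.2 i (by omega)]
    have h := step (n + m - (i + 1)) (by omega)
    rwa [show n + m - (i + 1) + 1 = n + m - i by omega] at h
end

section
/- Let f(q) = Σ_{j=0}^n a_j q^j be a real polynomial palindromic of darga n with nonnegative coefficients such that every complex root of f is real, and write f(q) = Σ_{i=0}^{⌊n/2⌋} b_i q^i (1+q)^{n−2i}. Then the polynomial Σ_{i=0}^{⌊n/2⌋} b_i q^i has nonnegative coefficients and every complex root of it is real. In particular, b_i ≥ 0 for all i, i.e., f is B-positive. -/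
open Polynomial

lemma coeff_prod_nonneg (s : Multiset ℂ) (hs : ∀ r ∈ s, r.im = 0 ∧ r.re ≤ 0) :
    ∀ i, ((s.map (fun r => X - C r)).prod.coeff i).im = 0 ∧
      0 ≤ ((s.map (fun r => X - C r)).prod.coeff i).re := by
  induction s using Multiset.induction_on with
  | empty =>
    intro i
    simp only [Multiset.map_zero, Multiset.prod_zero, coeff_one]
    split_ifs <;> simp
  | cons a s ih =>
    have ih' := ih (fun r hr => hs r (Multiset.mem_cons_of_mem hr))
    have ha := hs a (Multiset.mem_cons_self a s)
    intro i
    rw [Multiset.map_cons, Multiset.prod_cons]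
    generalize (s.map (fun r => X - C r)).prod = p at ih'
    cases i with
    | zero =>
      have h := ih' 0
      simp only [sub_mul, coeff_sub, coeff_C_mul, coeff_X_mul_zero, Complex.sub_im,
        Complex.sub_re, Complex.mul_im, Complex.mul_re, ha.1, h.1, Complex.zero_re,
        Complex.zero_im]
      constructor
      · simp
      · nlinarith [mul_nonneg (neg_nonneg.2 ha.2) h.2]
    | succ j =>
      have h := ih' (j + 1)
      have h' := ih' j
      simp only [sub_mul, coeff_sub, coeff_C_mul, coeff_X_mul, Complex.sub_im,
        Complex.sub_re, Complex.mul_im, Complex.mul_re, ha.1, h.1, h'.1]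
      constructor
      · simp
      · nlinarith [mul_nonneg (neg_nonneg.2 ha.2) h.2, h'.2]

lemma coeff_nonneg_of_roots (g : Polynomial ℝ) (x : ℝ) (hx : 0 ≤ x) (hgx : 0 < g.eval x)
    (h : ∀ z : ℂ, (g.map (algebraMap ℝ ℂ)).IsRoot z → z.im = 0 ∧ z.re ≤ 0) (i : ℕ) :
    0 ≤ g.coeff i := by
  have hg : g.map (algebraMap ℝ ℂ) ≠ 0 := by
    intro h0
    have : g = 0 := (Polynomial.map_eq_zero _).1 h0
    simp [this] at hgx
  have hsp := (IsAlgClosed.splits (g.map (algebraMap ℝ ℂ))).eq_prod_roots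
  have hp := coeff_prod_nonneg (g.map (algebraMap ℝ ℂ)).roots
    (fun r hr => h r ((mem_roots hg).1 hr))
  generalize ((g.map (algebraMap ℝ ℂ)).roots.map (fun r => X - C r)).prod = p at hsp hp
  have key : ∀ j, g.coeff j = g.leadingCoeff * (p.coeff j).re := by
    intro j
    have h1 := congrArg (fun q => (q.coeff j).re) hsp
    simpa [coeff_map, leadingCoeff_map, coeff_C_mul] using h1
  rcases le_or_gt 0 g.leadingCoeff with hc | hc
  · rw [key]; exact mul_nonneg hc (hp i).2
  · exfalso
    rw [eval_eq_sum_range] at hgx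
    refine absurd hgx (not_lt.2 (Finset.sum_nonpos fun j _ => ?_))
    rw [key]
    exact mul_nonpos_of_nonpos_of_nonneg
      (mul_nonpos_of_nonpos_of_nonneg hc.le (hp j).2) (pow_nonneg hx j)

/-- let `f` be palindromic of darga `n` with nonnegative
coefficients and only real (complex) roots, and write
`f = Σ_{i=0}^{⌊n/2⌋} b_i q^i (1+q)^{n-2i}`. Then `Σ_{i=0}^{⌊n/2⌋} b_i q^i` has
nonnegative coefficients and only real roots; in particular all `b_i ≥ 0`,
i.e. `f` is B-positive. -/
theorem real_rooted_is_B_positive (n : ℕ) (f : Polynomial ℝ)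
    (hpal : PalinDarga f n) (hcoeff : ∀ i, 0 ≤ f.coeff i)
    (hroots : ∀ z : ℂ, (f.map (algebraMap ℝ ℂ)).IsRoot z → z.im = 0)
    (b : ℕ → ℝ)
    (hb : f = ∑ i ∈ Finset.range (n / 2 + 1), C (b i) * X ^ i * (1 + X) ^ (n - 2 * i)) :
    (∀ i ≤ n / 2, 0 ≤ b i) ∧
      (∀ z : ℂ,
        ((∑ i ∈ Finset.range (n / 2 + 1), C (b i) * X ^ i : Polynomial ℝ).map
            (algebraMap ℝ ℂ)).IsRoot z → z.im = 0) := by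
  have hf0 : f ≠ 0 := by
    rintro h0
    have := hroots Complex.I (by simp [h0])
    simp at this
  have hpos : ∀ x : ℝ, 0 < x → 0 < f.eval x := by
    intro x hx
    rw [eval_eq_sum_range]
    refine Finset.sum_pos' (fun j _ => mul_nonneg (hcoeff j) (pow_nonneg hx.le j))
      ⟨f.natDegree, by simp, ?_⟩
    refine mul_pos (lt_of_le_of_ne (hcoeff _) (Ne.symm ?_)) (pow_pos hx _)
    simpa using hf0
  set g : Polynomial ℝ := ∑ i ∈ Finset.range (n / 2 + 1), C (b i) * X ^ i with hg
  have hrel : ∀ q w : ℂ, w * (1 + q) ^ 2 = q →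
      (f.map (algebraMap ℝ ℂ)).eval q = (1 + q) ^ n * (g.map (algebraMap ℝ ℂ)).eval w := by
    intro q w hw
    rw [hb, hg]
    simp only [Polynomial.map_sum, eval_finsetSum, Finset.mul_sum, Polynomial.map_mul,
      Polynomial.map_pow, Polynomial.map_add, Polynomial.map_one, map_X, map_C, eval_mul,
      eval_pow, eval_add, eval_one, eval_X, eval_C]
    refine Finset.sum_congr rfl fun i hi => ?_
    have hi' : n = 2 * i + (n - 2 * i) := by
      have := Finset.mem_range.1 hi
      omega
    have e : (1 + q) ^ n = ((1 + q) ^ 2) ^ i * (1 + q) ^ (n - 2 * i) := by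
      rw [← pow_mul, ← pow_add, ← hi']
    have e2 : q ^ i = w ^ i * ((1 + q) ^ 2) ^ i := by rw [← mul_pow, hw]
    rw [e, e2]
    ring
  have hroot : ∀ z : ℂ, (g.map (algebraMap ℝ ℂ)).IsRoot z → z.im = 0 ∧ z.re ≤ 0 := by
    intro w hw
    by_cases hw0 : w = 0
    · simp [hw0]
    obtain ⟨s, hs⟩ := IsAlgClosed.exists_pow_nat_eq (1 - 4 * w) (n := 2) (by norm_num)
    obtain ⟨q, hq⟩ : ∃ q : ℂ, w * (1 + q) ^ 2 = q := by
      refine ⟨(1 - 2 * w + s) / (2 * w), ?_⟩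
      field_simp
      linear_combination hs
    have hfq : (f.map (algebraMap ℝ ℂ)).IsRoot q := by
      rw [IsRoot.def, hrel q w hq, hw.eq_zero, mul_zero]
    have him := hroots q hfq
    obtain ⟨x, rfl⟩ : ∃ x : ℝ, q = (x : ℂ) := ⟨q.re, Complex.ext (by simp) (by simp [him])⟩
    have hfx : f.eval x = 0 := by
      have h1 : (f.map (algebraMap ℝ ℂ)).eval ((algebraMap ℝ ℂ) x) = 0 := hfq
      rw [eval_map_algebraMap, aeval_algebraMap_apply] at h1
      simpa using h1
    have hx : x ≤ 0 := by
      by_contra hx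
      exact (hpos x (not_le.1 hx)).ne' hfx
    have hx1 : (1 + x) ≠ 0 := by
      intro h
      have h' : (1 + (x : ℂ)) = 0 := by exact_mod_cast h
      rw [h'] at hq
      have h2 : x = 0 := by
        have : (x : ℂ) = 0 := by rw [← hq]; ring
        exact_mod_cast this
      rw [h2] at h
      norm_num at h
    have hwx : w = ((x / (1 + x) ^ 2 : ℝ) : ℂ) := by
      have h' : (1 + (x : ℂ)) ≠ 0 := by exact_mod_cast hx1
      push_cast
      rw [eq_div_iff (pow_ne_zero 2 h'), hq]
    rw [hwx]
    refine ⟨Complex.ofReal_im _, ?_⟩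
    rw [Complex.ofReal_re]
    exact div_nonpos_of_nonpos_of_nonneg hx (sq_nonneg _)
  refine ⟨fun i hi => ?_, fun z hz => (hroot z hz).1⟩
  have hg4 : 0 < g.eval (1 / 4) := by
    have h1 := hrel ((1 : ℝ) : ℂ) ((1 / 4 : ℝ) : ℂ) (by push_cast; norm_num)
    have h2 : ∀ (p : Polynomial ℝ) (x : ℝ),
        (p.map (algebraMap ℝ ℂ)).eval (x : ℂ) = ((p.eval x : ℝ) : ℂ) := by
      intro p x
      have := eval_map_algebraMap (B := ℂ) p ((algebraMap ℝ ℂ) x)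
      rw [aeval_algebraMap_apply] at this
      simpa using this
    rw [h2, h2] at h1
    have h3 : f.eval 1 = (1 + 1) ^ n * g.eval (1 / 4) := by exact_mod_cast h1
    have h4 := hpos 1 one_pos
    rw [h3] at h4
    exact pos_of_mul_pos_right h4 (by positivity)
  have := coeff_nonneg_of_roots g (1 / 4) (by norm_num) hg4 hroot i
  have hc : g.coeff i = b i := by
    rw [hg, finsetSum_coeff]
    simp only [coeff_C_mul, coeff_X_pow, mul_ite, mul_one, mul_zero]
    rw [Finset.sum_ite_eq, if_pos (Finset.mem_range.2 (by omega))]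
  rwa [hc] at this
end
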